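/- Let (u, v, ℓ) be a reduced triple: u divides ℓ, gcd(u, v) = 1, and 1 ≤ v ≤ ℓ/u. Set s = ℓ/u and r = ℓ/gcd(v, s), and let j be an integer with gcd(j, s) = 1 and j·(v/gcd(v,s)) ≡ 1 (mod gcd(r, s)). Suppose p is a prime with p ≡ 1 (mod ℓ), g is an integer whose multiplicative order modulo p equals ℓ, and a, b are integers with a ≡ g^{ℓ/r} (mod p) and b ≡ g^{j·ℓ/s} (mod p). Then ord_p(a) = r, ord_p(b) = s, lcm(r, s) = ℓ, r/gcd(r, s) = u, and a^u ≡ b^v (mod p). -/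

import Mathlib

/-- Given a reduced triple `(u,v,ℓ)` (so `u ∣ ℓ`, `gcd(u,v) = 1`, `1 ≤ v ≤ ℓ/u`),
set `s = ℓ/u`, `r = ℓ/gcd(v,s)` and take `j` with `gcd(j,s) = 1` and
`j·(v/gcd(v,s)) ≡ 1 (mod gcd(r,s))`.  If `p` is a prime with `p ≡ 1 (mod ℓ)`,
`g` has multiplicative order `ℓ` mod `p`, and `a ≡ g^(ℓ/r)`, `b ≡ g^(j·ℓ/s) (mod p)`,
then `ord_p a = r`, `ord_p b = s`, `lcm(r,s) = ℓ`, `r/gcd(r,s) = u`, and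
`a^u ≡ b^v (mod p)`. -/
theorem create_prime_for_reduced_triple
    (u v ℓ : ℕ) (hℓ : 1 ≤ ℓ) (huℓ : u ∣ ℓ) (huv : Nat.gcd u v = 1)
    (hv1 : 1 ≤ v) (hv2 : v ≤ ℓ / u)
    (s r j : ℕ) (hs : s = ℓ / u) (hr : r = ℓ / Nat.gcd v s)
    (hj1 : Nat.gcd j s = 1) (hj2 : j * (v / Nat.gcd v s) ≡ 1 [MOD Nat.gcd r s])
    (p : ℕ) (hp : p.Prime) (hpℓ : p ≡ 1 [MOD ℓ])
    (g : ZMod p) (hg : orderOf g = ℓ)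
    (a b : ℤ) (hab : (a : ZMod p) = g ^ (ℓ / r)) (hbb : (b : ZMod p) = g ^ (j * (ℓ / s))) :
    orderOf (a : ZMod p) = r ∧ orderOf (b : ZMod p) = s ∧
    Nat.lcm r s = ℓ ∧ r / Nat.gcd r s = u ∧
    (a : ZMod p) ^ u = (b : ZMod p) ^ v := by
  have hu : 0 < u := Nat.pos_of_dvd_of_pos huℓ hℓ
  obtain ⟨s', rfl⟩ := huℓ
  rw [Nat.mul_div_cancel_left _ hu] at hs
  subst hs
  have hs0 : 0 < s := Nat.pos_of_mul_pos_left hℓ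
  have hd0 : 0 < Nat.gcd v s := Nat.gcd_pos_of_pos_left _ hv1
  obtain ⟨d, w, t, hd, hcop, hvw, hst⟩ : ∃ d w t, Nat.gcd v s = d ∧ Nat.Coprime w t ∧
      v = d * w ∧ s = d * t :=
    ⟨Nat.gcd v s, v / Nat.gcd v s, s / Nat.gcd v s, rfl, Nat.coprime_div_gcd_div_gcd hd0,
      (Nat.mul_div_cancel' (Nat.gcd_dvd_left v s)).symm,
      (Nat.mul_div_cancel' (Nat.gcd_dvd_right v s)).symm⟩
  rw [hd] at hr hj2 hd0
  clear hd hv2 hpℓ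
  subst hvw
  subst hst
  have ht0 : 0 < t := Nat.pos_of_ne_zero (by rintro rfl; simp at hs0)
  have hr' : r = u * t := by
    rw [hr, show u * (d * t) = d * (u * t) by ring, Nat.mul_div_cancel_left _ hd0]
  clear hr
  subst hr'
  have hud : Nat.Coprime u d := Nat.Coprime.coprime_mul_right_right huv
  have hgcd : Nat.gcd (u * t) (d * t) = t := by
    rw [Nat.gcd_mul_right, hud.gcd_eq_one, one_mul]
  have h1 : u * (d * t) / (u * t) = d := by
    rw [show u * (d * t) = d * (u * t) by ring]
    exact Nat.mul_div_cancel _ (by positivity)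
  have h2 : u * (d * t) / (d * t) = u := Nat.mul_div_cancel _ hs0
  rw [hgcd, Nat.mul_div_cancel_left _ hd0] at hj2
  rw [h1] at hab
  rw [h2] at hbb
  rw [hab, hbb, hgcd]
  have hou : orderOf (g ^ u) = d * t := by
    rw [orderOf_pow_of_dvd hu.ne' (by rw [hg]; exact dvd_mul_right _ _), hg,
      Nat.mul_div_cancel_left _ hu]
  refine ⟨?_, ?_, ?_, Nat.mul_div_cancel _ ht0, ?_⟩
  · rw [orderOf_pow_of_dvd hd0.ne' (by rw [hg]; exact ⟨u * t, by ring⟩), hg,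
      show u * (d * t) = d * (u * t) by ring, Nat.mul_div_cancel_left _ hd0]
  · rw [mul_comm j u, pow_mul, Nat.Coprime.orderOf_pow, hou]
    rw [hou]
    exact (Nat.Coprime.symm hj1)
  · rw [Nat.lcm_mul_right, hud.lcm_eq_mul, mul_assoc]
  · rw [← pow_mul, ← pow_mul]
    have hm : d * u ≡ j * u * (d * w) [MOD orderOf g] := by
      rw [hg]
      have := (hj2.symm).mul_left' (d * u)
      rw [show u * (d * t) = d * u * t by ring, show j * u * (d * w) = d * u * (j * w) by ring]
      simpa using this
    rw [← pow_mod_orderOf g (d * u), ← pow_mod_orderOf g (j * u * (d * w)), hm]
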